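/- arXiv:1307.1671 — 3 statements merged into one kernel-verified Lean document; each statement's English description precedes it below -/
import Mathlib

section
/- Let A ∈ ℝ^{n×n}, C ∈ ℝ^{m×n}, N ≥ 1 an integer with W := [Cᵀ, AᵀCᵀ, …, A^{(N−1)T}Cᵀ]ᵀ of full column rank n, and R ∈ ℝ^{m×m} symmetric positive definite. Define Q := Σ_{i=0}^{N−2} A^{iT} Cᵀ R C A^i and H := A^{(N−1)T} Cᵀ R C A^{N−1}. Then Q + H is nonsingular, and for all z ∈ ℝ^n, y ∈ ℝ^m, the function ξ ↦ J(ξ, z, y) := ‖C A^{N−1} ξ − y‖²_R + Σ_{i=0}^{N−2} ‖C A^i ξ − C A^i z‖²_R attains its unique minimum at η = (Q+H)^{−1} A^{(N−1)T} Cᵀ R y + (Q+H)^{−1} Q z. -/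
open Matrix Filter Finset

/-- `‖v‖²_R = vᵀ R v`. -/
noncomputable def quadForm {m : ℕ} (R : Matrix (Fin m) (Fin m) ℝ) (v : Fin m → ℝ) : ℝ :=
  v ⬝ᵥ R.mulVec v

/-- The cost `J(ξ, z, y) = ‖C A^{N-1} ξ - y‖²_R + Σ_{i=0}^{N-2} ‖C A^i ξ - C A^i z‖²_R`. -/
noncomputable def Jcost {n m : ℕ} (A : Matrix (Fin n) (Fin n) ℝ) (C : Matrix (Fin m) (Fin n) ℝ)
    (R : Matrix (Fin m) (Fin m) ℝ) (N : ℕ) (ξ z : Fin n → ℝ) (y : Fin m → ℝ) : ℝ :=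
  quadForm R ((C * A ^ (N - 1)).mulVec ξ - y) +
    ∑ i ∈ Finset.range (N - 1), quadForm R ((C * A ^ i).mulVec ξ - (C * A ^ i).mulVec z)

/-- `Q := Σ_{i=0}^{N-2} A^{iT} Cᵀ R C A^i`. -/
noncomputable def Qmat {n m : ℕ} (A : Matrix (Fin n) (Fin n) ℝ) (C : Matrix (Fin m) (Fin n) ℝ)
    (R : Matrix (Fin m) (Fin m) ℝ) (N : ℕ) : Matrix (Fin n) (Fin n) ℝ :=
  ∑ i ∈ Finset.range (N - 1), (A ^ i)ᵀ * Cᵀ * R * C * A ^ i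

/-- `H := A^{(N-1)T} Cᵀ R C A^{N-1}`. -/
noncomputable def Hmat {n m : ℕ} (A : Matrix (Fin n) (Fin n) ℝ) (C : Matrix (Fin m) (Fin n) ℝ)
    (R : Matrix (Fin m) (Fin m) ℝ) (N : ℕ) : Matrix (Fin n) (Fin n) ℝ :=
  (A ^ (N - 1))ᵀ * Cᵀ * R * C * A ^ (N - 1)

theorem quadForm_add {m : ℕ} {R : Matrix (Fin m) (Fin m) ℝ} (hR : R.IsSymm) (u v : Fin m → ℝ) :
    quadForm R (u + v) = quadForm R u + 2 * (v ⬝ᵥ R *ᵥ u) + quadForm R v := by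
  have h : u ⬝ᵥ R *ᵥ v = v ⬝ᵥ R *ᵥ u := by
    rw [dotProduct_mulVec, ← mulVec_transpose, hR.eq, dotProduct_comm]
  simp only [quadForm, mulVec_add, add_dotProduct, dotProduct_add, h]
  ring

theorem quadForm_mulVec {n m : ℕ} (R : Matrix (Fin m) (Fin m) ℝ) (G : Matrix (Fin m) (Fin n) ℝ)
    (v : Fin n → ℝ) : quadForm R (G *ᵥ v) = v ⬝ᵥ (Gᵀ * R * G) *ᵥ v := by
  rw [quadForm, ← mulVec_mulVec, ← mulVec_mulVec, dotProduct_mulVec v, vecMul_transpose]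

theorem quadForm_nonneg {m : ℕ} {R : Matrix (Fin m) (Fin m) ℝ} (hR : R.PosDef) (v : Fin m → ℝ) :
    0 ≤ quadForm R v := by
  simpa [quadForm] using hR.posSemidef.dotProduct_mulVec_nonneg v

theorem quadForm_pos {m : ℕ} {R : Matrix (Fin m) (Fin m) ℝ} (hR : R.PosDef) {v : Fin m → ℝ}
    (hv : v ≠ 0) : 0 < quadForm R v := by
  simpa [quadForm] using hR.dotProduct_mulVec_pos hv

theorem Hmat_eq {n m : ℕ} (A : Matrix (Fin n) (Fin n) ℝ) (C : Matrix (Fin m) (Fin n) ℝ)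
    (R : Matrix (Fin m) (Fin m) ℝ) (N : ℕ) :
    Hmat A C R N = (C * A ^ (N - 1))ᵀ * R * (C * A ^ (N - 1)) := by
  simp only [Hmat, transpose_mul, Matrix.mul_assoc]

theorem Qmat_eq {n m : ℕ} (A : Matrix (Fin n) (Fin n) ℝ) (C : Matrix (Fin m) (Fin n) ℝ)
    (R : Matrix (Fin m) (Fin m) ℝ) (N : ℕ) :
    Qmat A C R N = ∑ i ∈ range (N - 1), (C * A ^ i)ᵀ * R * (C * A ^ i) := by
  simp only [Qmat, transpose_mul, Matrix.mul_assoc]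

theorem dotProduct_Qmat_add_Hmat {n m : ℕ} (A : Matrix (Fin n) (Fin n) ℝ)
    (C : Matrix (Fin m) (Fin n) ℝ) (R : Matrix (Fin m) (Fin m) ℝ) (N : ℕ) (v : Fin n → ℝ) :
    v ⬝ᵥ (Qmat A C R N + Hmat A C R N) *ᵥ v =
      ∑ i ∈ range (N - 1), quadForm R ((C * A ^ i) *ᵥ v) +
        quadForm R ((C * A ^ (N - 1)) *ᵥ v) := by
  simp only [Qmat_eq, Hmat_eq, add_mulVec, sum_mulVec, dotProduct_add, dotProduct_sum,
    quadForm_mulVec]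

/-- The exact second-order expansion of the cost in its first argument. -/
theorem Jcost_add {n m : ℕ} (A : Matrix (Fin n) (Fin n) ℝ) (C : Matrix (Fin m) (Fin n) ℝ)
    {R : Matrix (Fin m) (Fin m) ℝ} (hR : R.IsSymm) (N : ℕ) (x d z : Fin n → ℝ) (y : Fin m → ℝ) :
    Jcost A C R N (x + d) z y = Jcost A C R N x z y +
      2 * (d ⬝ᵥ ((Qmat A C R N + Hmat A C R N) *ᵥ x -
        (((A ^ (N - 1))ᵀ * Cᵀ * R) *ᵥ y + Qmat A C R N *ᵥ z))) +
      d ⬝ᵥ (Qmat A C R N + Hmat A C R N) *ᵥ d := by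
  have expand (G : Matrix (Fin m) (Fin n) ℝ) (b : Fin m → ℝ) :
      quadForm R (G *ᵥ (x + d) - b) = quadForm R (G *ᵥ x - b) +
        2 * (d ⬝ᵥ (Gᵀ * R * G) *ᵥ x - d ⬝ᵥ (Gᵀ * R) *ᵥ b) + quadForm R (G *ᵥ d) := by
    rw [mulVec_add, add_sub_right_comm, quadForm_add hR, ← vecMul_transpose G d, ← dotProduct_mulVec,
      mulVec_sub, mulVec_sub, dotProduct_sub, mulVec_mulVec, mulVec_mulVec, mulVec_mulVec,
      vecMul_transpose]
  rw [dotProduct_Qmat_add_Hmat]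
  simp only [Jcost, expand, Qmat_eq, Hmat_eq, sum_add_distrib, ← mul_sum, sum_sub_distrib,
    add_mulVec, sum_mulVec, dotProduct_add, dotProduct_sub, dotProduct_sum, mulVec_mulVec,
    transpose_mul, Matrix.mul_assoc]
  ring

theorem dotProduct_Qmat_add_Hmat_pos {n m : ℕ} {A : Matrix (Fin n) (Fin n) ℝ}
    {C : Matrix (Fin m) (Fin n) ℝ} {N : ℕ}
    (hW : (Matrix.of fun (p : Fin N × Fin m) (j : Fin n) =>
      (C * A ^ (p.1 : ℕ)) p.2 j).rank = n)
    {R : Matrix (Fin m) (Fin m) ℝ} (hR : R.PosDef) {v : Fin n → ℝ} (hv : v ≠ 0) :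
    0 < v ⬝ᵥ (Qmat A C R N + Hmat A C R N) *ᵥ v := by
  rw [dotProduct_Qmat_add_Hmat, ← sum_range_succ (fun i => quadForm R ((C * A ^ i) *ᵥ v))]
  have hinj : Function.Injective (Matrix.of fun (p : Fin N × Fin m) (j : Fin n) =>
      (C * A ^ (p.1 : ℕ)) p.2 j).mulVec := by
    rw [mulVec_injective_iff, linearIndependent_iff_card_eq_finrank_span]
    exact (Fintype.card_fin n).trans (hW.symm.trans (rank_eq_finrank_span_cols _))
  obtain ⟨⟨i, k⟩, hik⟩ : ∃ p, ((Matrix.of fun (p : Fin N × Fin m) (j : Fin n) =>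
      (C * A ^ (p.1 : ℕ)) p.2 j) *ᵥ v) p ≠ 0 := by
    by_contra! h
    exact hv (hinj (by rw [mulVec_zero]; exact funext h))
  refine sum_pos' (fun _ _ => quadForm_nonneg hR _) ⟨i, ?_, quadForm_pos hR fun h => hik ?_⟩
  · have := i.isLt
    rw [mem_range]
    omega
  · exact congrFun h k

/-- **Closed form of the optimal estimate (eqn. `eqn:eta`).**
`Q + H` is nonsingular and `η = (Q+H)⁻¹ A^{(N-1)T} Cᵀ R y + (Q+H)⁻¹ Q z` is the
unique minimizer of `ξ ↦ J(ξ, z, y)`. -/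
theorem stmt_2 {n m : ℕ} (A : Matrix (Fin n) (Fin n) ℝ) (C : Matrix (Fin m) (Fin n) ℝ)
    (N : ℕ) (hN : 1 ≤ N)
    (hW : (Matrix.of fun (p : Fin N × Fin m) (j : Fin n) =>
      (C * A ^ (p.1 : ℕ)) p.2 j).rank = n)
    (R : Matrix (Fin m) (Fin m) ℝ) (hR : R.PosDef) :
    IsUnit (Qmat A C R N + Hmat A C R N).det ∧
      ∀ (z : Fin n → ℝ) (y : Fin m → ℝ), ∀ ξ : Fin n → ℝ,
        ξ ≠ ((Qmat A C R N + Hmat A C R N)⁻¹ * (A ^ (N - 1))ᵀ * Cᵀ * R).mulVec y +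
            ((Qmat A C R N + Hmat A C R N)⁻¹ * Qmat A C R N).mulVec z →
          Jcost A C R N
              (((Qmat A C R N + Hmat A C R N)⁻¹ * (A ^ (N - 1))ᵀ * Cᵀ * R).mulVec y +
                ((Qmat A C R N + Hmat A C R N)⁻¹ * Qmat A C R N).mulVec z) z y
            < Jcost A C R N ξ z y := by
  have hdet : IsUnit (Qmat A C R N + Hmat A C R N).det := by
    rw [isUnit_iff_ne_zero]
    intro h
    obtain ⟨v, hv, hv0⟩ := exists_mulVec_eq_zero_iff.mpr h
    have hpos := dotProduct_Qmat_add_Hmat_pos hW hR hv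
    rw [hv0, dotProduct_zero] at hpos
    exact hpos.false
  refine ⟨hdet, fun z y ξ hξ => ?_⟩
  set η := ((Qmat A C R N + Hmat A C R N)⁻¹ * (A ^ (N - 1))ᵀ * Cᵀ * R).mulVec y +
    ((Qmat A C R N + Hmat A C R N)⁻¹ * Qmat A C R N).mulVec z with hη
  have hcrit : (Qmat A C R N + Hmat A C R N) *ᵥ η =
      ((A ^ (N - 1))ᵀ * Cᵀ * R) *ᵥ y + Qmat A C R N *ᵥ z := by
    simp only [hη, mulVec_add, mulVec_mulVec, Matrix.mul_assoc,
      mul_nonsing_inv_cancel_left _ _ hdet]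
  have hsymm : R.IsSymm := by simpa [IsHermitian, IsSymm] using hR.isHermitian
  have hpos := dotProduct_Qmat_add_Hmat_pos hW hR (sub_ne_zero.mpr hξ)
  have hJ := Jcost_add A C hsymm N η (ξ - η) z y
  rw [add_sub_cancel, hcrit, sub_self, dotProduct_zero, mul_zero, add_zero] at hJ
  linarith
end

section
/- Let (X, ρ_x) and (Y, ρ_y) be complete metric spaces, f : X → X and h : X → Y uniformly continuous, N ≥ 2 an integer, and ℓ : Y × Y → ℝ_{≥0} a symmetric function satisfying α₁(ρ_y(v,w)) ≤ ℓ(v,w) ≤ α₂(ρ_y(v,w)) for all v, w ∈ Y, with α₁, α₂ ∈ K∞. Define J(ξ, z, y) := ℓ(h(f^{N−1}(ξ)), y) + Σ_{i=0}^{N−2} ℓ(h(f^i(ξ)), h(f^i(z))). Assume there exists α₃ ∈ K∞ with Σ_{i=0}^{N−1} ℓ(h(f^i(z)), h(f^i(x̃))) ≥ α₃(ρ_x(z, x̃)) for all z, x̃ ∈ X, and there exists α₅ ∈ K∞ with ρ_x(f(ξ), f(ζ)) ≤ α₅(ρ_x(ξ, ζ)) for all ξ, ζ ∈ X. Let (x_k)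 solve x_{k+1} = f(x_k) with y_k = h(x_k), let (z_k), (η_k) satisfy z_{k+1} = f(η_k) where for each k, η_k minimizes ξ ↦ J(ξ, z_k, y_k), and set x̂_k := f^{N−1}(z_k). Suppose that for some δ ≥ 0 and some k₁ ∈ ℕ one has J(η_k, z_k, y_k) ≤ δ for all k ≥ k₁. Then for all k ≥ k₁ + N, ρ_x(x̂_k, x_k) ≤ α₅^N(α₃^{−1}(Σ_{q=1}^{N} α₂(q · α₁^{−1}(δ)))). -/
open Filter Finset

/-- A function `α : ℝ≥0 → ℝ≥0` of class `K∞`: continuous, zero at zero, strictly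
increasing, and unbounded (modelled on `ℝ`, restricted to `[0, ∞)`). -/
def IsKInf (α : ℝ → ℝ) : Prop :=
  ContinuousOn α (Set.Ici 0) ∧ α 0 = 0 ∧ StrictMonoOn α (Set.Ici 0) ∧
    Tendsto α atTop atTop

/-- The cost `J(ξ, z, y) = ℓ(h f^{N-1} ξ, y) + Σ_{i=0}^{N-2} ℓ(h f^i ξ, h f^i z)`. -/
def Jnl {X Y : Type*} (f : X → X) (h : X → Y) (ℓ : Y → Y → ℝ) (N : ℕ)
    (ξ z : X) (y : Y) : ℝ :=
  ℓ (h (f^[N - 1] ξ)) y + ∑ i ∈ Finset.range (N - 1), ℓ (h (f^[i] ξ)) (h (f^[i] z))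

namespace IsKInf

variable {α β : ℝ → ℝ}

theorem nonneg (hα : IsKInf α) {s : ℝ} (hs : 0 ≤ s) : 0 ≤ α s := by
  have := hα.2.2.1.monotoneOn Set.self_mem_Ici hs hs
  rwa [hα.2.1] at this

theorem mono (hα : IsKInf α) {s t : ℝ} (hs : 0 ≤ s) (hst : s ≤ t) : α s ≤ α t :=
  hα.2.2.1.monotoneOn hs (hs.trans hst) hst

theorem exists_eq (hα : IsKInf α) {s : ℝ} (hs : 0 ≤ s) : ∃ t, 0 ≤ t ∧ α t = s := by
  obtain ⟨b, hsb, hb⟩ := ((hα.2.2.2.eventually_ge_atTop s).and (eventually_ge_atTop 0)).exists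
  obtain ⟨t, ht, hts⟩ := intermediate_value_Icc hb (hα.1.mono Set.Icc_subset_Ici_self)
    ⟨hα.2.1.trans_le hs, hsb⟩
  exact ⟨t, ht.1, hts⟩

/-- The inverse of a `K∞` function bounds the points of its sublevel sets. -/
theorem le_inv (hα : IsKInf α)
    (hβ : ∀ s ∈ Set.Ici (0 : ℝ), β (α s) = s ∧ α (β s) = s)
    {s t : ℝ} (ht : 0 ≤ t) (hts : α t ≤ s) : t ≤ β s := by
  obtain ⟨u, hu, rfl⟩ := hα.exists_eq ((hα.nonneg ht).trans hts)
  rw [(hβ u hu).1]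
  exact (hα.2.2.1.le_iff_le ht hu).1 hts

end IsKInf

theorem dist_iterate_le_iterate_of_dist_le {X : Type*} [MetricSpace X] {f : X → X} {α : ℝ → ℝ}
    (hα : IsKInf α) (hf : ∀ ξ ζ : X, dist (f ξ) (f ζ) ≤ α (dist ξ ζ)) {ξ ζ : X} {r : ℝ}
    (hr : dist ξ ζ ≤ r) (n : ℕ) : dist (f^[n] ξ) (f^[n] ζ) ≤ α^[n] r := by
  induction n with
  | zero => exact hr
  | succ n ih =>
    simp only [Function.iterate_succ_apply']
    exact (hf _ _).trans (hα.mono dist_nonneg ih)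

/-- **The claim (eqn. `eqn:claimNL`) in the proof of Theorem 4, quantitatively.**
If `J(η_k, z_k, y_k) ≤ δ` for all `k ≥ k₁`, then for all `k ≥ k₁ + N`,
`ρ_x(x̂_k, x_k) ≤ α₅^N(α₃⁻¹(Σ_{q=1}^N α₂(q · α₁⁻¹(δ))))`. -/
theorem stmt_13 {X Y : Type*} [MetricSpace X] [MetricSpace Y]
    [CompleteSpace X] [CompleteSpace Y]
    (f : X → X) (h : X → Y) (hf : UniformContinuous f) (hh : UniformContinuous h)
    (N : ℕ) (hN : 2 ≤ N)
    (ℓ : Y → Y → ℝ) (hsym : ∀ v w, ℓ v w = ℓ w v)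
    (α₁ α₂ : ℝ → ℝ) (hα₁ : IsKInf α₁) (hα₂ : IsKInf α₂)
    (hℓ : ∀ v w, α₁ (dist v w) ≤ ℓ v w ∧ ℓ v w ≤ α₂ (dist v w))
    (α₃ : ℝ → ℝ) (hα₃ : IsKInf α₃)
    (hobs : ∀ z xt : X, α₃ (dist z xt) ≤ ∑ i ∈ Finset.range N, ℓ (h (f^[i] z)) (h (f^[i] xt)))
    (α₅ : ℝ → ℝ) (hα₅ : IsKInf α₅)
    (hfmod : ∀ ξ ζ : X, dist (f ξ) (f ζ) ≤ α₅ (dist ξ ζ))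
    (α₁inv α₃inv : ℝ → ℝ)
    (hα₁inv : ∀ s ∈ Set.Ici (0 : ℝ), α₁inv (α₁ s) = s ∧ α₁ (α₁inv s) = s)
    (hα₃inv : ∀ s ∈ Set.Ici (0 : ℝ), α₃inv (α₃ s) = s ∧ α₃ (α₃inv s) = s)
    (x z η : ℕ → X)
    (hx : ∀ k, x (k + 1) = f (x k))
    (hηmin : ∀ k (ξ : X),
      Jnl f h ℓ N (η k) (z k) (h (x k)) ≤ Jnl f h ℓ N ξ (z k) (h (x k)))
    (hz : ∀ k, z (k + 1) = f (η k))
    (δ : ℝ) (hδ : 0 ≤ δ) (k₁ : ℕ)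
    (hJ : ∀ k, k₁ ≤ k → Jnl f h ℓ N (η k) (z k) (h (x k)) ≤ δ) :
    ∀ k, k₁ + N ≤ k →
      dist (f^[N - 1] (z k)) (x k) ≤
        α₅^[N] (α₃inv (∑ q ∈ Finset.Icc 1 N, α₂ ((q : ℝ) * α₁inv δ))) := by
  have hx_iter : ∀ i j, f^[i] (x j) = x (j + i) := by
    intro i j
    induction i with
    | zero => rfl
    | succ i ih => rw [Function.iterate_succ_apply', ih, ← hx, Nat.add_assoc]
  have hℓ_nonneg : ∀ v w, 0 ≤ ℓ v w := fun v w => (hα₁.nonneg dist_nonneg).trans (hℓ v w).1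
  have dist_le : ∀ v w, ℓ v w ≤ δ → dist v w ≤ α₁inv δ := fun v w hvw =>
    hα₁.le_inv hα₁inv dist_nonneg ((hℓ v w).1.trans hvw)
  have output_le : ∀ k, k₁ ≤ k → dist (h (f^[N - 1] (η k))) (h (x k)) ≤ α₁inv δ := fun k hk =>
    dist_le _ _ ((le_add_of_nonneg_right
      (Finset.sum_nonneg fun _ _ => hℓ_nonneg _ _)).trans (hJ k hk))
  have prior_le : ∀ k, k₁ ≤ k → ∀ i < N - 1,
      dist (h (f^[i] (η k))) (h (f^[i] (z k))) ≤ α₁inv δ := fun k hk i hi =>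
    dist_le _ _ ((Finset.single_le_sum
      (f := fun i => ℓ (h (f^[i] (η k))) (h (f^[i] (z k))))
      (fun _ _ => hℓ_nonneg _ _) (Finset.mem_range.2 hi)).trans
        ((le_add_of_nonneg_left (hℓ_nonneg _ _)).trans (hJ k hk)))
  have window_le : ∀ m < N, ∀ j, k₁ ≤ j →
      dist (h (f^[N - 1 - m] (η (j + m)))) (h (x j)) ≤ ((m + 1 : ℕ) : ℝ) * α₁inv δ := by
    intro m
    induction m with
    | zero =>
      intro _ j hj
      simpa using output_le j hj
    | succ m ih =>
      intro hm j hj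
      have h₁ := prior_le (j + (m + 1)) (by omega) (N - 1 - (m + 1)) (by omega)
      have h₂ := ih (by omega) j hj
      rw [← Nat.add_assoc, hz, ← Function.iterate_succ_apply,
        show (N - 1 - (m + 1)).succ = N - 1 - m by omega] at h₁
      refine (dist_triangle _ _ _).trans ((add_le_add h₁ h₂).trans_eq ?_)
      push_cast
      ring
  intro k hk
  obtain ⟨j, rfl⟩ : ∃ j, k = j + N := ⟨k - N, by omega⟩
  have hstate : dist (η (j + (N - 1))) (x j) ≤
      α₃inv (∑ q ∈ Finset.Icc 1 N, α₂ ((q : ℝ) * α₁inv δ)) := by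
    refine hα₃.le_inv hα₃inv dist_nonneg ((hobs _ _).trans ?_)
    rw [← Finset.sum_range_reflect, ← Finset.Ico_add_one_right_eq_Icc,
      Finset.sum_Ico_eq_sum_range, Nat.add_sub_cancel]
    refine Finset.sum_le_sum fun m hm => (hℓ _ _).2.trans (hα₂.mono dist_nonneg ?_)
    have hmN := Finset.mem_range.1 hm
    have := window_le m hmN (j + (N - 1 - m)) (by omega)
    rw [show j + (N - 1 - m) + m = j + (N - 1) by omega] at this
    rwa [hx_iter, Nat.add_comm 1 m]
  have := dist_iterate_le_iterate_of_dist_le hα₅ hfmod hstate N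
  rw [hx_iter] at this
  rwa [show j + N = j + (N - 1) + 1 by omega, hz, ← Function.iterate_succ_apply,
    show (N - 1).succ = N by omega, show j + (N - 1) + 1 = j + N by omega]
end

section
/- Let (X, ρ_x) and (Y, ρ_y) be complete metric spaces, f : X → X and h : X → Y, N ≥ 2 an integer, and ℓ : Y × Y → ℝ_{≥0} a symmetric function. Define J(ξ, z, y) := ℓ(h(f^{N−1}(ξ)), y) + Σ_{i=0}^{N−2} ℓ(h(f^i(ξ)), h(f^i(z))). Assume there exist η : X × Y → X and α₄ ∈ K∞ such that for all z, x̃ ∈ X, writing η = η(z, h(f^{N−1}(x̃))), α₄(J(η, z, h(f^{N−1}(x̃)))) + Σ_{i=0}^{N−1} ℓ(h(f^i(η)), h(f^i(x̃))) ≤ Σ_{i=0}^{N−2} ℓ(h(f^i(z)), h(f^i(x̃))). Let (x_k) solve x_{k+1} = f(x_k) with y_k = h(x_k), let z_{k+1} = f(η(z_k, y_k)), and write x̃_k := x_{k−N+1} for k ≥ N−1. Then for every k₀ ≥ N−1, Σ_{k=k₀}^{∞} α₄(J(η(z_k, y_k), z_k, y_k)) ≤ Σ_{i=0}^{N−2}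 ℓ(h(f^i(z_{k₀})), h(f^i(x̃_{k₀}))); in particular J(η(z_k, y_k), z_k, y_k) → 0 as k → ∞. -/
open Filter Finset

/-- A nonnegative function `V` dissipated at rate `a` bounds the total dissipation. -/
theorem summable_and_tsum_le_of_dissipation {a V : ℕ → ℝ} (ha : ∀ n, 0 ≤ a n) (hV : ∀ n, 0 ≤ V n)
    (hdiss : ∀ n, a n + V (n + 1) ≤ V n) : Summable a ∧ ∑' n, a n ≤ V 0 := by
  have hpartial : ∀ n, ∑ i ∈ Finset.range n, a i ≤ V 0 := by
    intro n
    have hsum : ∑ i ∈ Finset.range n, a i ≤ ∑ i ∈ Finset.range n, (V i - V (i + 1)) :=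
      Finset.sum_le_sum fun i _ => by linarith [hdiss i]
    rw [Finset.sum_range_sub'] at hsum
    linarith [hV n]
  exact ⟨summable_of_sum_range_le ha hpartial, Real.tsum_le_of_sum_range_le ha hpartial⟩

theorem IsKInf.nonneg_s15 {α : ℝ → ℝ} (hα : IsKInf α) {t : ℝ} (ht : 0 ≤ t) : 0 ≤ α t := by
  simpa only [hα.2.1] using
    hα.2.2.1.monotoneOn (Set.mem_Ici.2 le_rfl) (Set.mem_Ici.2 ht) ht

/-- A nonnegative function tends to zero as soon as its image under a `K∞` function does. -/
theorem IsKInf.tendsto_zero_of_comp {ι : Type*} {l : Filter ι} {α : ℝ → ℝ} (hα : IsKInf α)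
    {u : ι → ℝ} (hu : ∀ k, 0 ≤ u k) (h : Tendsto (fun k => α (u k)) l (nhds 0)) :
    Tendsto u l (nhds 0) := by
  rw [tendsto_order]
  refine ⟨fun b hb => Eventually.of_forall fun k => hb.trans_le (hu k), fun ε hε => ?_⟩
  have hpos : 0 < α ε := by
    simpa only [hα.2.1] using hα.2.2.1 (Set.mem_Ici.2 le_rfl) (Set.mem_Ici.2 hε.le) hε
  filter_upwards [h.eventually (gt_mem_nhds hpos)] with k hk
  exact (hα.2.2.1.lt_iff_lt (Set.mem_Ici.2 (hu k)) (Set.mem_Ici.2 hε.le)).1 hk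

theorem Jnl_nonneg {X Y : Type*} {f : X → X} {h : X → Y} {ℓ : Y → Y → ℝ}
    (hℓ : ∀ v w, 0 ≤ ℓ v w) (N : ℕ) (ξ z : X) (y : Y) : 0 ≤ Jnl f h ℓ N ξ z y :=
  add_nonneg (hℓ _ _) (Finset.sum_nonneg fun _ _ => hℓ _ _)

theorem apply_add_eq_iterate {X : Type*} {f : X → X} {x : ℕ → X}
    (hx : ∀ k, x (k + 1) = f (x k)) (m n : ℕ) : x (m + n) = f^[n] (x m) := by
  induction n with
  | zero => rfl
  | succ n ih => rw [← add_assoc, hx, ih, Function.iterate_succ_apply']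

/-- **Summability of the optimal costs (eqn. `eqn:Jsumbounded`).**
Under the decrease condition, for every `k₀ ≥ N-1` the tail sum
`Σ_{k=k₀}^∞ α₄(J(η(z_k, y_k), z_k, y_k))` is bounded by
`Σ_{i=0}^{N-2} ℓ(h f^i z_{k₀}, h f^i x̃_{k₀})` (with `x̃_k = x_{k-N+1}`);
in particular `J(η(z_k, y_k), z_k, y_k) → 0`. -/
theorem stmt_15 {X Y : Type*} [MetricSpace X] [MetricSpace Y]
    [CompleteSpace X] [CompleteSpace Y]
    (f : X → X) (h : X → Y)
    (N : ℕ) (hN : 2 ≤ N)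
    (ℓ : Y → Y → ℝ) (hsym : ∀ v w, ℓ v w = ℓ w v) (hℓ : ∀ v w, 0 ≤ ℓ v w)
    (η : X → Y → X)
    (α₄ : ℝ → ℝ) (hα₄ : IsKInf α₄)
    (hdecay : ∀ z xt : X,
      α₄ (Jnl f h ℓ N (η z (h (f^[N - 1] xt))) z (h (f^[N - 1] xt))) +
          ∑ i ∈ Finset.range N, ℓ (h (f^[i] (η z (h (f^[N - 1] xt))))) (h (f^[i] xt)) ≤
        ∑ i ∈ Finset.range (N - 1), ℓ (h (f^[i] z)) (h (f^[i] xt)))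
    (x z : ℕ → X)
    (hx : ∀ k, x (k + 1) = f (x k))
    (hz : ∀ k, z (k + 1) = f (η (z k) (h (x k)))) :
    (∀ k₀, N - 1 ≤ k₀ →
      Summable (fun j : ℕ =>
        α₄ (Jnl f h ℓ N (η (z (k₀ + j)) (h (x (k₀ + j)))) (z (k₀ + j)) (h (x (k₀ + j))))) ∧
      ∑' j : ℕ,
          α₄ (Jnl f h ℓ N (η (z (k₀ + j)) (h (x (k₀ + j)))) (z (k₀ + j)) (h (x (k₀ + j)))) ≤
        ∑ i ∈ Finset.range (N - 1),
          ℓ (h (f^[i] (z k₀))) (h (f^[i] (x (k₀ - (N - 1)))))) ∧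
    Tendsto (fun k => Jnl f h ℓ N (η (z k) (h (x k))) (z k) (h (x k))) atTop (nhds 0) := by
  have hJ : ∀ k, 0 ≤ Jnl f h ℓ N (η (z k) (h (x k))) (z k) (h (x k)) :=
    fun k => Jnl_nonneg hℓ N _ _ _
  have hdiss : ∀ m, α₄ (Jnl f h ℓ N (η (z (m + (N - 1))) (h (x (m + (N - 1)))))
        (z (m + (N - 1))) (h (x (m + (N - 1))))) +
      ∑ i ∈ Finset.range (N - 1), ℓ (h (f^[i] (z (m + (N - 1) + 1)))) (h (f^[i] (x (m + 1)))) ≤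
      ∑ i ∈ Finset.range (N - 1), ℓ (h (f^[i] (z (m + (N - 1))))) (h (f^[i] (x m))) := by
    intro m
    have hd := hdecay (z (m + (N - 1))) (x m)
    rw [← apply_add_eq_iterate hx] at hd
    obtain ⟨n, rfl⟩ : ∃ n, N = n + 1 := ⟨N - 1, by omega⟩
    rw [Finset.sum_range_succ'] at hd
    simp only [Nat.add_sub_cancel] at hd ⊢
    simp only [Function.iterate_succ_apply, ← hz, ← hx] at hd
    linarith [hℓ (h (f^[0] (η (z (m + n)) (h (x (m + n)))))) (h (f^[0] (x m)))]
  have hbound : ∀ k₀, N - 1 ≤ k₀ →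
      Summable (fun j : ℕ =>
        α₄ (Jnl f h ℓ N (η (z (k₀ + j)) (h (x (k₀ + j)))) (z (k₀ + j)) (h (x (k₀ + j))))) ∧
      ∑' j : ℕ,
          α₄ (Jnl f h ℓ N (η (z (k₀ + j)) (h (x (k₀ + j)))) (z (k₀ + j)) (h (x (k₀ + j)))) ≤
        ∑ i ∈ Finset.range (N - 1),
          ℓ (h (f^[i] (z k₀))) (h (f^[i] (x (k₀ - (N - 1))))) := by
    intro k₀ hk₀
    refine summable_and_tsum_le_of_dissipation
      (V := fun j => ∑ i ∈ Finset.range (N - 1),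
        ℓ (h (f^[i] (z (k₀ + j)))) (h (f^[i] (x (k₀ - (N - 1) + j)))))
      (fun j => hα₄.nonneg_s15 (hJ _)) (fun j => Finset.sum_nonneg fun _ _ => hℓ _ _) fun j => ?_
    have hd := hdiss (k₀ - (N - 1) + j)
    rwa [show k₀ - (N - 1) + j + (N - 1) = k₀ + j by omega] at hd
  refine ⟨hbound, hα₄.tendsto_zero_of_comp hJ ?_⟩
  rw [← tendsto_add_atTop_iff_nat (N - 1)]
  simpa only [add_comm] using (hbound (N - 1) le_rfl).1.tendsto_atTop_zero
end
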